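/- Let G be a simple Eulerian graph with two adjacent degree-6 vertices u, v whose common neighbourhood is N = {x1,...,x5} (so N(u) = N ∪ {v} and N(v) = N ∪ {u}), and suppose the induced graph G[N] contains a path y1y2y3y4 of length 3. If G′ = G − {u, v} has a legal colouring c′ in which the path y1y2y3y4 is not monochromatic, then G has a legal colouring. -/

import Mathlib

open SimpleGraph

def IsCycleEdgeSet {V : Type*} (G : SimpleGraph V) (s : Set (Sym2 V)) : Prop :=
  ∃ (v : V) (w : G.Walk v v), w.IsCycle ∧ s = {e | e ∈ w.edges}

def HasCycleDecompLE {V : Type*} (G : SimpleGraph V) (m : ℕ) : Prop :=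
  ∃ (n : ℕ) (f : Fin n → Set (Sym2 V)), n ≤ m ∧
    (∀ i, IsCycleEdgeSet G (f i)) ∧
    (Pairwise fun i j => Disjoint (f i) (f j)) ∧
    (⋃ i, f i) = G.edgeSet

def IsLegalColouringWith {V : Type*} (G : SimpleGraph V) (c : Sym2 V → ℕ) (m : ℕ) : Prop :=
  (∀ e ∈ G.edgeSet, 1 ≤ c e ∧ c e ≤ m) ∧
  ∀ i : ℕ, ({e ∈ G.edgeSet | c e = i}).Nonempty → IsCycleEdgeSet G {e ∈ G.edgeSet | c e = i}

def IsLegalColouring {V : Type*} [Fintype V] (G : SimpleGraph V) (c : Sym2 V → ℕ) : Prop :=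
  IsLegalColouringWith G c ((Fintype.card V - 1) / 2)

theorem cycle_path_of_edge {V : Type*} (G : SimpleGraph V) {a p q : V} (C : G.Walk a a)
    (hC : C.IsCycle) (h : s(p, q) ∈ C.edges) :
    ∃ t : G.Walk q p, t.IsPath ∧ s(p, q) ∉ t.edges ∧
      ∀ e, e ∈ C.edges ↔ (e = s(p, q) ∨ e ∈ t.edges) := by
  classical
  have hp : p ∈ C.support := C.fst_mem_support_of_mem_edges h
  have hR := hC.rotate hp
  have hE : ∀ e, e ∈ C.edges ↔ e ∈ (C.rotate p hp).edges := fun e =>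
    ((C.rotate_edges p hp).mem_iff).symm
  generalize C.rotate p hp = R at hR hE
  rw [hE] at h
  simp only [hE]
  clear hE hp hC
  cases R with
  | nil => simp at h
  | @cons _ y _ hadj t =>
    rw [Walk.cons_isCycle_iff] at hR
    rw [Walk.edges_cons, List.mem_cons] at h
    by_cases hqy : q = y
    · subst hqy
      exact ⟨t, hR.1, hR.2, by simp⟩
    · have h2 : s(p, q) ∈ t.edges := by
        rcases h with h | h
        · exfalso
          apply hqy
          simpa [hadj.ne] using h
        · exact h
      have hE2 : ∀ e, e ∈ t.edges ↔ e ∈ t.reverse.edges := by simp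
      have hP := hR.1.reverse
      have h3 := hR.2
      rw [hE2] at h2 h3
      simp only [Walk.edges_cons, List.mem_cons, hE2]
      generalize t.reverse = r at hP h2 h3
      cases r with
      | nil => simp at h2
      | @cons _ z _ hadj2 r =>
        rw [Walk.cons_isPath_iff] at hP
        rw [Walk.edges_cons, List.mem_cons] at h2
        have hqz : q = z := by
          rcases h2 with h2 | h2
          · simpa [hadj2.ne] using h2
          · exact absurd (r.fst_mem_support_of_mem_edges h2) hP.2
        subst hqz
        refine ⟨r.concat hadj.symm, ?_, ?_, ?_⟩
        · rw [Walk.concat_isPath_iff]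
          exact hP
        · rw [Walk.edges_concat]
          simp only [List.concat_eq_append, List.mem_append, List.mem_singleton, not_or]
          refine ⟨fun h => hP.2 (r.fst_mem_support_of_mem_edges h), ?_⟩
          intro h
          apply hqy
          rw [Sym2.eq_swap (a := y)] at h
          simpa [hadj.ne] using h
        · intro e
          rw [Walk.edges_concat]
          simp only [Walk.edges_cons, List.concat_eq_append, List.mem_append, List.mem_cons,
            Sym2.eq_swap (a := y)]
          tauto

theorem cycle_detour {V : Type*} (G : SimpleGraph V) (s : Set (Sym2 V)) (p q w : V)
    (hs : IsCycleEdgeSet G s) (hpq : s(p, q) ∈ s) (hw : ∀ e ∈ s, w ∉ e)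
    (h1 : G.Adj p w) (h2 : G.Adj w q) :
    IsCycleEdgeSet G ((s \ {s(p, q)}) ∪ {s(p, w), s(w, q)}) := by
  obtain ⟨a, C, hC, rfl⟩ := hs
  obtain ⟨t, ht, hnt, hE⟩ := cycle_path_of_edge G C hC hpq
  have hne : p ≠ q := (C.adj_of_mem_edges hpq).ne
  have hwt : w ∉ t.support := by
    intro hmem
    cases t with
    | nil => exact hne rfl
    | cons h r =>
      rw [Walk.mem_support_iff_exists_mem_edges] at hmem
      rcases hmem with hmem | ⟨e, he, hwe⟩
      · exact h1.ne hmem.symm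
      · exact hw e ((hE e).2 (Or.inr he)) hwe
  refine ⟨p, Walk.cons h1 (Walk.cons h2 t), ?_, ?_⟩
  · rw [Walk.cons_isCycle_iff, Walk.cons_isPath_iff]
    refine ⟨⟨ht, hwt⟩, ?_⟩
    rw [Walk.edges_cons, List.mem_cons, not_or]
    refine ⟨?_, fun h => hwt (t.snd_mem_support_of_mem_edges h)⟩
    rw [Sym2.eq_swap]
    simp [hne, h1.ne]
  · ext e
    simp only [Set.mem_union, Set.mem_sdiff, Set.mem_ofPred_eq, hE, Set.mem_singleton_iff,
      Set.mem_insert_iff, Walk.edges_cons, List.mem_cons]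
    constructor
    · tauto
    · rintro (h | h | h)
      · tauto
      · tauto
      · left
        exact ⟨Or.inr h, fun h' => hnt (h' ▸ h)⟩

/-- A partial legal colouring of the edge set `F`. -/
def GoodCol {V : Type*} (G : SimpleGraph V) (F : Set (Sym2 V)) (c : Sym2 V → ℕ) (m : ℕ) : Prop :=
  (∀ e ∈ F, 1 ≤ c e ∧ c e ≤ m) ∧
  ∀ i : ℕ, ({e ∈ F | c e = i}).Nonempty → IsCycleEdgeSet G {e ∈ F | c e = i}

theorem good_step {V : Type*} (G : SimpleGraph V) (F : Set (Sym2 V)) (c : Sym2 V → ℕ) (m : ℕ)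
    (hG : GoodCol G F c m) (p q w : V) (hpq : s(p, q) ∈ F)
    (h1 : G.Adj p w) (h2 : G.Adj w q) (n1 : s(p, w) ∉ F) (n2 : s(w, q) ∉ F)
    (hw : ∀ e ∈ F, w ∈ e → c e ≠ c s(p, q)) :
    ∃ d : Sym2 V → ℕ, GoodCol G ((F \ {s(p, q)}) ∪ {s(p, w), s(w, q)}) d m ∧
      d s(p, w) = c s(p, q) ∧ d s(w, q) = c s(p, q) ∧
      ∀ e, e ≠ s(p, w) → e ≠ s(w, q) → d e = c e := by
  classical
  let d : Sym2 V → ℕ := fun e => if e = s(p, w) ∨ e = s(w, q) then c s(p, q) else c e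
  have d1 : d s(p, w) = c s(p, q) := by simp [d]
  have d2 : d s(w, q) = c s(p, q) := by simp [d]
  have d3 : ∀ e, e ≠ s(p, w) → e ≠ s(w, q) → d e = c e := by
    intro e he1 he2
    simp [d, he1, he2]
  have d4 : ∀ e ∈ F, d e = c e := fun e he =>
    d3 e (fun h => n1 (h ▸ he)) (fun h => n2 (h ▸ he))
  clear_value d
  refine ⟨d, ⟨?_, ?_⟩, d1, d2, d3⟩
  · rintro e (⟨he, -⟩ | rfl | rfl)
    · rw [d4 e he]; exact hG.1 e he
    · rw [d1]; exact hG.1 _ hpq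
    · rw [d2]; exact hG.1 _ hpq
  · intro i hne
    by_cases hi : i = c s(p, q)
    · subst hi
      have := cycle_detour G _ p q w (hG.2 _ ⟨s(p, q), hpq, rfl⟩) ⟨hpq, rfl⟩
        (fun e he hwe => hw e he.1 hwe he.2) h1 h2
      convert this using 1
      ext e
      simp only [Set.mem_union, Set.mem_sdiff, Set.mem_ofPred_eq, Set.mem_singleton_iff,
        Set.mem_insert_iff]
      constructor
      · rintro ⟨⟨he, he2⟩ | he, hc⟩
        · left; rw [d4 e he] at hc; exact ⟨⟨he, hc⟩, he2⟩
        · right; exact he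
      · rintro (⟨⟨he, hc⟩, he2⟩ | rfl | rfl)
        · rw [d4 e he]; exact ⟨Or.inl ⟨he, he2⟩, hc⟩
        · exact ⟨by simp, d1⟩
        · exact ⟨by simp, d2⟩
    · have hEq : {e ∈ (F \ {s(p, q)}) ∪ {s(p, w), s(w, q)} | d e = i} = {e ∈ F | c e = i} := by
        ext e
        simp only [Set.mem_union, Set.mem_sdiff, Set.mem_ofPred_eq, Set.mem_singleton_iff,
          Set.mem_insert_iff]
        constructor
        · rintro ⟨⟨he, he2⟩ | rfl | rfl, hc⟩
          · rw [d4 e he] at hc; exact ⟨he, hc⟩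
          · exact absurd (hc.symm.trans d1) hi
          · exact absurd (hc.symm.trans d2) hi
        · rintro ⟨he, hc⟩
          rw [d4 e he]
          refine ⟨Or.inl ⟨he, ?_⟩, hc⟩
          rintro rfl
          exact hi hc.symm
      rw [hEq] at hne ⊢
      exact hG.2 i hne

theorem good_final {V : Type*} (G : SimpleGraph V) (F : Set (Sym2 V)) (c : Sym2 V → ℕ) (m : ℕ)
    (hG : GoodCol G F c m) (D : Set (Sym2 V)) (hD : IsCycleEdgeSet G D) (hdis : ∀ e ∈ D, e ∉ F)
    (hun : ∀ e, e ∈ G.edgeSet ↔ (e ∈ F ∨ e ∈ D)) :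
    ∃ c : Sym2 V → ℕ, IsLegalColouringWith G c (m + 1) := by
  classical
  refine ⟨fun e => if e ∈ D then m + 1 else c e, ?_, ?_⟩
  · intro e he
    by_cases h : e ∈ D
    · simp [h]
    · have := hG.1 e (by have := (hun e).1 he; tauto)
      simp only [h, if_false]
      omega
  · intro i hne
    by_cases hi : i = m + 1
    · convert hD using 1
      ext e
      simp only [Set.mem_ofPred_eq]
      constructor
      · rintro ⟨he, hc⟩
        by_contra h
        have := hG.1 e (by have := (hun e).1 he; tauto)
        simp only [h, if_false] at hc
        omega
      · intro h
        exact ⟨(hun e).2 (Or.inr h), by simp [h, hi]⟩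
    · have hEq : {e ∈ G.edgeSet | (if e ∈ D then m + 1 else c e) = i} = {e ∈ F | c e = i} := by
        ext e
        simp only [Set.mem_ofPred_eq]
        by_cases h : e ∈ D
        · have := hdis e h
          simp only [h, if_true, this, false_and, iff_false, not_and]
          intro _ h; exact hi h.symm
        · have := hun e
          simp only [h, if_false]
          tauto
      rw [hEq] at hne ⊢
      exact hG.2 i hne


/-- Abstract version of a detour step. -/
def StepOK {E : Type*} (Good : Set E → (E → ℕ) → Prop) (t : E → Prop) (e f g : E) : Prop :=
  ∀ (F : Set E) (c : E → ℕ), Good F c → e ∈ F → f ∉ F → g ∉ F →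
    (∀ a ∈ F, t a → c a ≠ c e) →
    ∃ d : E → ℕ, Good ((F \ {e}) ∪ {f, g}) d ∧ d f = c e ∧ d g = c e ∧
      ∀ a, a ≠ f → a ≠ g → d a = c a

theorem combi {E : Type*} (Good : Set E → (E → ℕ) → Prop) (tu tv : E → Prop) (F : Set E)
    (c : E → ℕ) (hgood : Good F c) (e12 e23 e34 uv u2 u3 u4 v1 v2 v3 : E)
    (h12 : e12 ∈ F) (h23 : e23 ∈ F) (h34 : e34 ∈ F)
    (n1 : e12 ≠ e23) (n2 : e12 ≠ e34) (n3 : e23 ≠ e34)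
    (hFu : ∀ e ∈ F, ¬ tu e) (hFv : ∀ e ∈ F, ¬ tv e)
    (huv : tu uv ∧ tv uv) (hu2 : tu u2 ∧ ¬ tv u2) (hu3 : tu u3 ∧ ¬ tv u3) (hu4 : tu u4 ∧ ¬ tv u4)
    (hv1 : tv v1 ∧ ¬ tu v1) (hv2 : tv v2 ∧ ¬ tu v2) (hv3 : tv v3 ∧ ¬ tu v3)
    (k1 : u2 ≠ u3) (k2 : u2 ≠ u4) (k3 : u3 ≠ u4) (k4 : v1 ≠ v2) (k5 : v1 ≠ v3) (k6 : v2 ≠ v3)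
    (S1 : StepOK Good tv e12 v1 v2) (S2 : StepOK Good tu v2 uv u2)
    (S3 : StepOK Good tv e23 v2 v3) (S4 : StepOK Good tu e34 u3 u4)
    (S5 : StepOK Good tv u3 uv v3) (S6 : StepOK Good tu e23 u2 u3)
    (hmono : ¬ (c e12 = c e23 ∧ c e23 = c e34)) :
    ∃ d, Good ((F \ {e12, e23, e34}) ∪ {uv, u2, u3, u4, v1, v2, v3}) d := by
  unfold StepOK at *
  have w1 : uv ∉ F := fun h => hFu _ h huv.1
  have w2 : u2 ∉ F := fun h => hFu _ h hu2.1
  have w3 : u3 ∉ F := fun h => hFu _ h hu3.1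
  have w4 : u4 ∉ F := fun h => hFu _ h hu4.1
  have w5 : v1 ∉ F := fun h => hFv _ h hv1.1
  have w6 : v2 ∉ F := fun h => hFv _ h hv2.1
  have w7 : v3 ∉ F := fun h => hFv _ h hv3.1
  have hne : ∀ a ∈ F, a ≠ uv ∧ a ≠ u2 ∧ a ≠ u3 ∧ a ≠ u4 ∧ a ≠ v1 ∧ a ≠ v2 ∧ a ≠ v3 := by
    intro a ha
    refine ⟨?_, ?_, ?_, ?_, ?_, ?_, ?_⟩ <;> rintro rfl <;> contradiction
  have hne12 := hne _ h12
  have hne23 := hne _ h23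
  have hne34 := hne _ h34
  have hneu : ∀ a, ¬ tv a → a ≠ uv ∧ a ≠ v1 ∧ a ≠ v2 ∧ a ≠ v3 := by
    intro a ha
    refine ⟨?_, ?_, ?_, ?_⟩ <;> rintro rfl <;> tauto
  have hneu2 := hneu _ hu2.2
  have hneu3 := hneu _ hu3.2
  have hneu4 := hneu _ hu4.2
  have hnev : ∀ a, ¬ tu a → a ≠ uv := by
    rintro a ha rfl
    tauto
  have hnev1 := hnev _ hv1.2
  have hnev2 := hnev _ hv2.2
  have hnev3 := hnev _ hv3.2
  clear hneu hnev
  by_cases hA : c e12 ≠ c e23 ∧ c e12 ≠ c e34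
  · obtain ⟨c1, g1, a1, b1, f1⟩ := S1 F c hgood h12 w5 w6 (by clear * - hFv; grind)
    obtain ⟨c2, g2, a2, b2, f2⟩ := S2 _ c1 g1 (by simp)
      (by clear S1 S2 S3 S4 S5 S6; simp only [Set.mem_union, Set.mem_sdiff, Set.mem_insert_iff, Set.mem_singleton_iff]; grind (splits := 30)) (by clear S1 S2 S3 S4 S5 S6; simp only [Set.mem_union, Set.mem_sdiff, Set.mem_insert_iff, Set.mem_singleton_iff]; grind (splits := 30))
      (by clear S1 S2 S3 S4 S5 S6; simp only [Set.mem_union, Set.mem_sdiff, Set.mem_insert_iff, Set.mem_singleton_iff]; grind (splits := 30))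
    obtain ⟨c3, g3, a3, b3, f3⟩ := S3 _ c2 g2 (by clear S1 S2 S3 S4 S5 S6; simp only [Set.mem_union, Set.mem_sdiff, Set.mem_insert_iff, Set.mem_singleton_iff]; grind (splits := 30))
      (by clear S1 S2 S3 S4 S5 S6; simp only [Set.mem_union, Set.mem_sdiff, Set.mem_insert_iff, Set.mem_singleton_iff]; grind (splits := 30)) (by clear S1 S2 S3 S4 S5 S6; simp only [Set.mem_union, Set.mem_sdiff, Set.mem_insert_iff, Set.mem_singleton_iff]; grind (splits := 30))
      (by clear S1 S2 S3 S4 S5 S6; simp only [Set.mem_union, Set.mem_sdiff, Set.mem_insert_iff, Set.mem_singleton_iff]; grind (splits := 30))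
    obtain ⟨c4, g4, a4, b4, f4⟩ := S4 _ c3 g3 (by clear S1 S2 S3 S4 S5 S6; simp only [Set.mem_union, Set.mem_sdiff, Set.mem_insert_iff, Set.mem_singleton_iff]; grind (splits := 30))
      (by clear S1 S2 S3 S4 S5 S6; simp only [Set.mem_union, Set.mem_sdiff, Set.mem_insert_iff, Set.mem_singleton_iff]; grind (splits := 30)) (by clear S1 S2 S3 S4 S5 S6; simp only [Set.mem_union, Set.mem_sdiff, Set.mem_insert_iff, Set.mem_singleton_iff]; grind (splits := 30))
      (by clear S1 S2 S3 S4 S5 S6; simp only [Set.mem_union, Set.mem_sdiff, Set.mem_insert_iff, Set.mem_singleton_iff]; grind (splits := 30))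
    refine ⟨c4, ?_⟩
    convert g4 using 1
    clear S1 S2 S3 S4 S5 S6 f1 f2 f3 f4 g1 g2 g3 g4 a1 a2 a3 a4 b1 b2 b3 b4
    ext a
    simp only [Set.mem_union, Set.mem_sdiff, Set.mem_insert_iff, Set.mem_singleton_iff]
    grind (splits := 30)
  by_cases hB : c e34 ≠ c e23 ∧ c e34 ≠ c e12
  · obtain ⟨c1, g1, a1, b1, f1⟩ := S4 F c hgood h34 w3 w4 (by clear * - hFu; grind)
    obtain ⟨c2, g2, a2, b2, f2⟩ := S5 _ c1 g1 (by simp)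
      (by clear S1 S2 S3 S4 S5 S6; simp only [Set.mem_union, Set.mem_sdiff, Set.mem_insert_iff, Set.mem_singleton_iff]; grind (splits := 30)) (by clear S1 S2 S3 S4 S5 S6; simp only [Set.mem_union, Set.mem_sdiff, Set.mem_insert_iff, Set.mem_singleton_iff]; grind (splits := 30))
      (by clear S1 S2 S3 S4 S5 S6; simp only [Set.mem_union, Set.mem_sdiff, Set.mem_insert_iff, Set.mem_singleton_iff]; grind (splits := 30))
    obtain ⟨c3, g3, a3, b3, f3⟩ := S1 _ c2 g2 (by clear S1 S2 S3 S4 S5 S6; simp only [Set.mem_union, Set.mem_sdiff, Set.mem_insert_iff, Set.mem_singleton_iff]; grind (splits := 30))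
      (by clear S1 S2 S3 S4 S5 S6; simp only [Set.mem_union, Set.mem_sdiff, Set.mem_insert_iff, Set.mem_singleton_iff]; grind (splits := 30)) (by clear S1 S2 S3 S4 S5 S6; simp only [Set.mem_union, Set.mem_sdiff, Set.mem_insert_iff, Set.mem_singleton_iff]; grind (splits := 30))
      (by clear S1 S2 S3 S4 S5 S6; simp only [Set.mem_union, Set.mem_sdiff, Set.mem_insert_iff, Set.mem_singleton_iff]; grind (splits := 30))
    obtain ⟨c4, g4, a4, b4, f4⟩ := S6 _ c3 g3 (by clear S1 S2 S3 S4 S5 S6; simp only [Set.mem_union, Set.mem_sdiff, Set.mem_insert_iff, Set.mem_singleton_iff]; grind (splits := 30))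
      (by clear S1 S2 S3 S4 S5 S6; simp only [Set.mem_union, Set.mem_sdiff, Set.mem_insert_iff, Set.mem_singleton_iff]; grind (splits := 30)) (by clear S1 S2 S3 S4 S5 S6; simp only [Set.mem_union, Set.mem_sdiff, Set.mem_insert_iff, Set.mem_singleton_iff]; grind (splits := 30))
      (by clear S1 S2 S3 S4 S5 S6; simp only [Set.mem_union, Set.mem_sdiff, Set.mem_insert_iff, Set.mem_singleton_iff]; grind (splits := 30))
    refine ⟨c4, ?_⟩
    convert g4 using 1
    clear S1 S2 S3 S4 S5 S6 f1 f2 f3 f4 g1 g2 g3 g4 a1 a2 a3 a4 b1 b2 b3 b4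
    ext a
    simp only [Set.mem_union, Set.mem_sdiff, Set.mem_insert_iff, Set.mem_singleton_iff]
    grind (splits := 30)
  have hC : c e12 = c e34 ∧ c e12 ≠ c e23 := by
    clear * - hA hB hmono
    grind
  clear hA hB
  obtain ⟨c1, g1, a1, b1, f1⟩ := S6 F c hgood h23 w2 w3 (by clear * - hFu; grind)
  obtain ⟨c2, g2, a2, b2, f2⟩ := S5 _ c1 g1 (by simp)
    (by clear S1 S2 S3 S4 S5 S6; simp only [Set.mem_union, Set.mem_sdiff, Set.mem_insert_iff, Set.mem_singleton_iff]; grind (splits := 30)) (by clear S1 S2 S3 S4 S5 S6; simp only [Set.mem_union, Set.mem_sdiff, Set.mem_insert_iff, Set.mem_singleton_iff]; grind (splits := 30))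
    (by clear S1 S2 S3 S4 S5 S6; simp only [Set.mem_union, Set.mem_sdiff, Set.mem_insert_iff, Set.mem_singleton_iff]; grind (splits := 30))
  obtain ⟨c3, g3, a3, b3, f3⟩ := S1 _ c2 g2 (by clear S1 S2 S3 S4 S5 S6; simp only [Set.mem_union, Set.mem_sdiff, Set.mem_insert_iff, Set.mem_singleton_iff]; grind (splits := 30))
    (by clear S1 S2 S3 S4 S5 S6; simp only [Set.mem_union, Set.mem_sdiff, Set.mem_insert_iff, Set.mem_singleton_iff]; grind (splits := 30)) (by clear S1 S2 S3 S4 S5 S6; simp only [Set.mem_union, Set.mem_sdiff, Set.mem_insert_iff, Set.mem_singleton_iff]; grind (splits := 30))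
    (by clear S1 S2 S3 S4 S5 S6; simp only [Set.mem_union, Set.mem_sdiff, Set.mem_insert_iff, Set.mem_singleton_iff]; grind (splits := 30))
  obtain ⟨c4, g4, a4, b4, f4⟩ := S4 _ c3 g3 (by clear S1 S2 S3 S4 S5 S6; simp only [Set.mem_union, Set.mem_sdiff, Set.mem_insert_iff, Set.mem_singleton_iff]; grind (splits := 30))
    (by clear S1 S2 S3 S4 S5 S6; simp only [Set.mem_union, Set.mem_sdiff, Set.mem_insert_iff, Set.mem_singleton_iff]; grind (splits := 30)) (by clear S1 S2 S3 S4 S5 S6; simp only [Set.mem_union, Set.mem_sdiff, Set.mem_insert_iff, Set.mem_singleton_iff]; grind (splits := 30))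
    (by clear S1 S2 S3 S4 S5 S6; simp only [Set.mem_union, Set.mem_sdiff, Set.mem_insert_iff, Set.mem_singleton_iff]; grind (splits := 30))
  refine ⟨c4, ?_⟩
  convert g4 using 1
  clear S1 S2 S3 S4 S5 S6 f1 f2 f3 f4 g1 g2 g3 g4 a1 a2 a3 a4 b1 b2 b3 b4
  ext a
  simp only [Set.mem_union, Set.mem_sdiff, Set.mem_insert_iff, Set.mem_singleton_iff]
  grind (splits := 30)

theorem stepOK_of {V : Type*} (G : SimpleGraph V) (m : ℕ) (p q w : V) (e f g : Sym2 V)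
    (he : e = s(p, q)) (hf : f = s(p, w)) (hg : g = s(w, q)) (h1 : G.Adj p w) (h2 : G.Adj w q) :
    StepOK (fun F c => GoodCol G F c m) (fun e => w ∈ e) e f g := by
  subst he hf hg
  intro F c hG hpq n1 n2 hw
  exact good_step G F c m hG p q w hpq h1 h2 n1 n2 hw

set_option linter.unusedSimpArgs false
set_option maxHeartbeats 1000000

theorem stmt_16 {V : Type*} [Fintype V] (G : SimpleGraph V) (u v : V) (N : Set V)
    (hEuler : ∀ w : V, Even ((G.neighborSet w).ncard))
    (huv : G.Adj u v) (huN : u ∉ N) (hvN : v ∉ N)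
    (hNu : G.neighborSet u = N ∪ {v}) (hNv : G.neighborSet v = N ∪ {u})
    (hN5 : N.ncard = 5)
    (y1 y2 y3 y4 : V)
    (hy : y1 ∈ N ∧ y2 ∈ N ∧ y3 ∈ N ∧ y4 ∈ N)
    (hydist : y1 ≠ y2 ∧ y1 ≠ y3 ∧ y1 ≠ y4 ∧ y2 ≠ y3 ∧ y2 ≠ y4 ∧ y3 ≠ y4)
    (hpath : G.Adj y1 y2 ∧ G.Adj y2 y3 ∧ G.Adj y3 y4)
    (c' : Sym2 V → ℕ)
    (hc' : IsLegalColouringWith (G.deleteEdges {e | u ∈ e ∨ v ∈ e}) c'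
      ((Fintype.card V - 3) / 2))
    (hmono : ¬ (c' s(y1, y2) = c' s(y2, y3) ∧ c' s(y2, y3) = c' s(y3, y4))) :
    ∃ c : Sym2 V → ℕ, IsLegalColouringWith G c ((Fintype.card V - 1) / 2) := by
  obtain ⟨hy1, hy2, hy3, hy4⟩ := hy
  obtain ⟨n12, n13, n14, n23, n24, n34⟩ := hydist
  obtain ⟨p12, p23, p34⟩ := hpath
  obtain ⟨x, hxN, hx1, hx2, hx3, hx4, hNx⟩ : ∃ x ∈ N, x ≠ y1 ∧ x ≠ y2 ∧ x ≠ y3 ∧ x ≠ y4 ∧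
      ∀ z ∈ N, z = y1 ∨ z = y2 ∨ z = y3 ∨ z = y4 ∨ z = x := by
    classical
    have hsub : ({y1, y2, y3, y4} : Set V) ⊆ N := by
      rintro z (rfl | rfl | rfl | rfl) <;> assumption
    have h4 : ({y1, y2, y3, y4} : Set V).ncard = 4 := by
      rw [Set.ncard_insert_of_notMem, Set.ncard_insert_of_notMem, Set.ncard_pair] <;> simp [*]
    have h1 : (N \ {y1, y2, y3, y4}).ncard = 1 := by
      rw [Set.ncard_sdiff hsub, hN5, h4]
    obtain ⟨x, hx⟩ := Set.ncard_eq_one.1 h1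
    have hx' : x ∈ N \ {y1, y2, y3, y4} := by rw [hx]; rfl
    simp only [Set.mem_sdiff, Set.mem_insert_iff, Set.mem_singleton_iff, not_or] at hx'
    refine ⟨x, hx'.1, hx'.2.1, hx'.2.2.1, hx'.2.2.2.1, hx'.2.2.2.2, ?_⟩
    intro z hz
    by_contra hcon
    simp only [not_or] at hcon
    have : z ∈ N \ {y1, y2, y3, y4} := by
      simp only [Set.mem_sdiff, Set.mem_insert_iff, Set.mem_singleton_iff]
      tauto
    rw [hx] at this
    exact hcon.2.2.2.2 this
  have au : ∀ z, G.Adj u z ↔ z ∈ N ∨ z = v := fun z => by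
    rw [← SimpleGraph.mem_neighborSet, hNu]; simp [or_comm]
  have av : ∀ z, G.Adj v z ↔ z ∈ N ∨ z = u := fun z => by
    rw [← SimpleGraph.mem_neighborSet, hNv]; simp [or_comm]
  have hcard : 3 ≤ Fintype.card V := by
    rw [← Nat.card_eq_fintype_card]
    have := Set.ncard_le_card N
    omega
  have hm : (Fintype.card V - 1) / 2 = (Fintype.card V - 3) / 2 + 1 := by omega
  rw [hm]
  generalize (Fintype.card V - 3) / 2 = m at hc'
  have hF : ∃ F : Set (Sym2 V), F = {e | e ∈ G.edgeSet ∧ u ∉ e ∧ v ∉ e} := ⟨_, rfl⟩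
  obtain ⟨F, hF⟩ := hF
  have hFm : ∀ e, e ∈ F ↔ (e ∈ G.edgeSet ∧ u ∉ e ∧ v ∉ e) := by
    intro e; rw [hF]; rfl
  have hFE : (G.deleteEdges {e | u ∈ e ∨ v ∈ e}).edgeSet = F := by
    ext e
    rw [hFm, SimpleGraph.edgeSet_deleteEdges]
    simp
  have hgood : GoodCol G F c' m := by
    refine ⟨fun e he => hc'.1 e (hFE ▸ he), ?_⟩
    intro i hne
    rw [← hFE] at hne ⊢
    obtain ⟨a, C, hC, hs⟩ := hc'.2 i hne
    refine ⟨a, C.mapLe (SimpleGraph.deleteEdges_le _), hC.mapLe _, ?_⟩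
    rw [hs]; simp
  have u1 : G.Adj u y1 := (au _).2 (Or.inl hy1)
  have u2 : G.Adj u y2 := (au _).2 (Or.inl hy2)
  have u3 : G.Adj u y3 := (au _).2 (Or.inl hy3)
  have u4 : G.Adj u y4 := (au _).2 (Or.inl hy4)
  have u5 : G.Adj u x := (au _).2 (Or.inl hxN)
  have v1 : G.Adj v y1 := (av _).2 (Or.inl hy1)
  have v2 : G.Adj v y2 := (av _).2 (Or.inl hy2)
  have v3 : G.Adj v y3 := (av _).2 (Or.inl hy3)
  have v4 : G.Adj v y4 := (av _).2 (Or.inl hy4)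
  have v5 : G.Adj v x := (av _).2 (Or.inl hxN)
  have m12 : s(y1, y2) ∈ F := by
    rw [hFm]; simp [p12, u1.ne, u2.ne, v1.ne, v2.ne]
  have m23 : s(y2, y3) ∈ F := by
    rw [hFm]; simp [p23, u2.ne, u3.ne, v2.ne, v3.ne]
  have m34 : s(y3, y4) ∈ F := by
    rw [hFm]; simp [p34, u3.ne, u4.ne, v3.ne, v4.ne]
  have hFu : ∀ e ∈ F, u ∉ e := fun e he => ((hFm e).1 he).2.1
  have hFv : ∀ e ∈ F, v ∉ e := fun e he => ((hFm e).1 he).2.2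
  have hFu' : ∀ z, s(u, z) ∉ F := fun z h => hFu _ h (by simp)
  have hFv' : ∀ z, s(v, z) ∉ F := fun z h => hFv _ h (by simp)
  have hFu2 : ∀ z, s(z, u) ∉ F := fun z h => hFu _ h (by simp)
  have hFv2 : ∀ z, s(z, v) ∉ F := fun z h => hFv _ h (by simp)
  have hcover : ∀ e, e ∈ G.edgeSet ↔ (e ∈ F ∨ e = s(u, v) ∨
      e = s(u, y1) ∨ e = s(u, y2) ∨ e = s(u, y3) ∨ e = s(u, y4) ∨ e = s(u, x) ∨
      e = s(v, y1) ∨ e = s(v, y2) ∨ e = s(v, y3) ∨ e = s(v, y4) ∨ e = s(v, x)) := by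
    intro e
    constructor
    · intro he
      by_cases hue : u ∈ e
      · obtain ⟨z, rfl⟩ := hue
        rcases (au z).1 he with hz | rfl
        · rcases hNx z hz with rfl | rfl | rfl | rfl | rfl <;> simp
        · simp
      · by_cases hve : v ∈ e
        · obtain ⟨z, rfl⟩ := hve
          rcases (av z).1 he with hz | rfl
          · rcases hNx z hz with rfl | rfl | rfl | rfl | rfl <;> simp
          · simp at hue
        · exact Or.inl ((hFm e).2 ⟨he, hue, hve⟩)
    · rintro (h | rfl | rfl | rfl | rfl | rfl | rfl | rfl | rfl | rfl | rfl | rfl)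
      · exact ((hFm e).1 h).1
      all_goals simpa
  have hD : IsCycleEdgeSet G {s(u, y1), s(y1, y2), s(y2, y3), s(y3, y4), s(y4, v), s(v, x),
      s(x, u)} := by
    refine ⟨u, Walk.cons u1 (Walk.cons p12 (Walk.cons p23 (Walk.cons p34 (Walk.cons v4.symm
      (Walk.cons v5 (Walk.cons u5.symm Walk.nil)))))), ?_, ?_⟩
    · rw [Walk.cons_isCycle_iff]
      simp [Walk.cons_isPath_iff, n12, n13, n14, n23, n24, n34, u1.ne, u2.ne, u3.ne, u4.ne, u5.ne,
        v1.ne, v2.ne, v3.ne, v4.ne, v5.ne, v1.ne', v2.ne', v3.ne', v4.ne', v5.ne', u1.ne', u2.ne',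
        u3.ne', u4.ne', u5.ne', hx1.symm, hx2.symm, hx3.symm, hx4.symm, huv.ne, huv.ne']
    · ext e
      simp
  have s1 : ∀ z w : V, s(z, w) = s(w, z) := fun z w => Sym2.eq_swap
  have q12 := n12.symm
  have q13 := n13.symm
  have q14 := n14.symm
  have q23 := n23.symm
  have q24 := n24.symm
  have q34 := n34.symm
  have eu1 := u1.ne
  have eu2 := u2.ne
  have eu3 := u3.ne
  have eu4 := u4.ne
  have eu5 := u5.ne
  have ev1 := v1.ne
  have ev2 := v2.ne
  have ev3 := v3.ne
  have ev4 := v4.ne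
  have ev5 := v5.ne
  have euv := huv.ne
  clear hc' hEuler hNu hNv hN5 hNx au av hFE hF hm hcard hFm
  obtain ⟨d, hd⟩ := combi (fun F c => GoodCol G F c m) (fun e => u ∈ e) (fun e => v ∈ e) F c' hgood
    s(y1, y2) s(y2, y3) s(y3, y4) s(u, v) s(u, y2) s(u, y3) s(u, y4) s(v, y1) s(v, y2) s(v, y3)
    m12 m23 m34 (by simp [*]) (by simp [*]) (by simp [*]) hFu hFv (by simp)
    (by simp [huv.ne', ev2]) (by simp [huv.ne', ev3]) (by simp [huv.ne', ev4])
    (by simp [huv.ne, eu1]) (by simp [huv.ne, eu2]) (by simp [huv.ne, eu3])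
    (by simp [n23, eu3]) (by simp [n24, eu4]) (by simp [n34, eu4])
    (by simp [n12, ev2]) (by simp [n13, ev3]) (by simp [n23, ev3])
    (stepOK_of G m y1 y2 v _ _ _ rfl (s1 _ _) rfl v1.symm v2)
    (stepOK_of G m v y2 u _ _ _ rfl (s1 _ _) rfl huv.symm u2)
    (stepOK_of G m y2 y3 v _ _ _ rfl (s1 _ _) rfl v2.symm v3)
    (stepOK_of G m y3 y4 u _ _ _ rfl (s1 _ _) rfl u3.symm u4)
    (stepOK_of G m u y3 v _ _ _ rfl rfl rfl huv v3)
    (stepOK_of G m y2 y3 u _ _ _ rfl (s1 _ _) rfl u2.symm u3)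
    hmono
  refine good_final G _ d m hd _ hD ?_ ?_
  · intro e he
    simp only [Set.mem_insert_iff, Set.mem_singleton_iff] at he
    rcases he with rfl | rfl | rfl | rfl | rfl | rfl | rfl <;>
      simp [*, u1.ne', u2.ne', u3.ne', u4.ne', u5.ne', v1.ne', v2.ne', v3.ne', v4.ne', v5.ne',
        huv.ne', -s1, hx1.symm, hx2.symm, hx3.symm, hx4.symm]
  · intro e
    rw [hcover]
    simp only [Set.mem_union, Set.mem_sdiff, Set.mem_insert_iff, Set.mem_singleton_iff]
    rw [s1 y4 v, s1 x u]
    have t1 : e = s(y1, y2) → e ∈ F := fun h => h ▸ m12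
    have t2 : e = s(y2, y3) → e ∈ F := fun h => h ▸ m23
    have t3 : e = s(y3, y4) → e ∈ F := fun h => h ▸ m34
    clear * - t1 t2 t3
    generalize (e = s(y1, y2)) = A0 at *
    generalize (e = s(y2, y3)) = A1 at *
    generalize (e = s(y3, y4)) = A2 at *
    generalize (e = s(u, v)) = A3 at *
    generalize (e = s(u, y1)) = A4 at *
    generalize (e = s(u, y2)) = A5 at *
    generalize (e = s(u, y3)) = A6 at *
    generalize (e = s(u, y4)) = A7 at *
    generalize (e = s(u, x)) = A8 at *
    generalize (e = s(v, y1)) = A9 at *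
    generalize (e = s(v, y2)) = A10 at *
    generalize (e = s(v, y3)) = A11 at *
    generalize (e = s(v, y4)) = A12 at *
    generalize (e = s(v, x)) = A13 at *
    generalize (e ∈ F) = B at *
    grind (splits := 40)
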